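/- arXiv:2009.09544 — 5 statements merged into one kernel-verified Lean document; each statement's English description precedes it below -/
import Mathlib

section
/- The incidence structure (P,L), where P = {1,...,81} and L is the explicitly listed family of 81 six-element subsets of P (with incidence given by membership), is a partial geometry with parameters pg(5,5,2): any two distinct points lie in at most one common member of L, every member of L has exactly 6 elements, every point lies in exactly 6 members of L, and for every point p and every B ∈ L with p ∉ B there are exactly 2 members of L containing p and meeting B. -/
/-- The point set `P = {1, ..., 81}`. -/
def pgPoints : Finset ℕ := Finset.Icc 1 81

/-- The 81 lines of the new partial geometry `pg(5,5,2)`. -/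
def pgLines : Finset (Finset ℕ) :=
  {{1, 8, 16, 32, 35, 38},
   {1, 14, 26, 59, 64, 71},
   {1, 15, 27, 39, 40, 48},
   {1, 17, 23, 62, 76, 77},
   {1, 19, 24, 30, 44, 54},
   {1, 22, 25, 60, 73, 80},
   {2, 5, 27, 63, 75, 76},
   {2, 10, 16, 60, 67, 79},
   {2, 11, 24, 66, 71, 72},
   {2, 12, 14, 28, 37, 38},
   {2, 20, 22, 34, 40, 52},
   {2, 21, 23, 30, 50, 51},
   {3, 8, 24, 34, 45, 53},
   {3, 14, 17, 67, 74, 81},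
   {3, 15, 16, 42, 43, 50},
   {3, 19, 27, 29, 33, 37},
   {3, 22, 26, 58, 63, 70},
   {3, 23, 25, 55, 65, 66},
   {4, 8, 27, 36, 41, 51},
   {4, 14, 25, 56, 69, 75},
   {4, 15, 24, 28, 31, 46},
   {4, 16, 19, 47, 49, 52},
   {4, 17, 22, 57, 72, 78},
   {4, 23, 26, 61, 68, 79},
   {5, 6, 17, 29, 31, 38},
   {5, 7, 24, 61, 73, 81},
   {5, 9, 16, 59, 65, 78},
   {5, 13, 26, 36, 44, 50},
   {5, 18, 25, 39, 45, 52},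
   {6, 8, 20, 73, 74, 79},
   {6, 10, 25, 30, 41, 43},
   {6, 11, 26, 40, 47, 53},
   {6, 12, 19, 64, 65, 72},
   {6, 15, 21, 70, 75, 77},
   {7, 10, 27, 55, 57, 64},
   {7, 11, 16, 58, 69, 77},
   {7, 12, 23, 39, 49, 53},
   {7, 14, 20, 36, 43, 54},
   {7, 21, 22, 29, 35, 46},
   {8, 12, 18, 62, 63, 69},
   {8, 13, 21, 55, 71, 78},
   {9, 10, 24, 56, 62, 70},
   {9, 11, 27, 68, 74, 80},
   {9, 12, 22, 41, 42, 44},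
   {9, 14, 21, 45, 47, 48},
   {9, 20, 23, 31, 32, 33},
   {10, 13, 17, 34, 48, 49},
   {10, 18, 26, 28, 33, 35},
   {11, 13, 25, 32, 37, 46},
   {11, 17, 18, 42, 51, 54},
   {12, 13, 15, 60, 68, 81},
   {13, 19, 20, 56, 58, 76},
   {15, 18, 20, 57, 59, 66},
   {18, 19, 21, 61, 67, 80},
   {28, 43, 53, 76, 78, 80},
   {28, 44, 52, 55, 74, 77},
   {28, 48, 51, 58, 65, 73},
   {29, 43, 52, 62, 68, 71},
   {29, 44, 48, 66, 69, 79},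
   {29, 51, 53, 56, 59, 60},
   {30, 33, 40, 69, 78, 81},
   {30, 38, 45, 57, 58, 68},
   {30, 46, 49, 59, 63, 74},
   {31, 34, 50, 64, 69, 80},
   {31, 39, 41, 58, 67, 71},
   {31, 47, 54, 55, 60, 63},
   {32, 43, 48, 61, 63, 72},
   {32, 44, 53, 57, 67, 75},
   {32, 51, 52, 64, 70, 81},
   {33, 36, 45, 60, 72, 77},
   {33, 42, 49, 71, 73, 75},
   {34, 35, 54, 65, 68, 75},
   {34, 37, 41, 59, 61, 77},
   {35, 39, 50, 56, 72, 74},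
   {35, 41, 47, 66, 76, 81},
   {36, 38, 49, 66, 70, 80},
   {36, 40, 46, 62, 65, 67},
   {37, 39, 54, 70, 78, 79},
   {37, 47, 50, 57, 62, 73},
   {38, 40, 42, 55, 56, 61},
   {42, 45, 46, 64, 76, 79}}

/-- The set of positions of the ones in the binary expansion of a natural number. -/
def bitSet : ℕ ≃ Finset ℕ := Finset.equivBitIndices

theorem mem_bitSet {i n : ℕ} : i ∈ bitSet n ↔ n.testBit i = true := by
  simp [bitSet, Finset.equivBitIndices]

theorem bitSet_inter_nonempty {m n : ℕ} : (bitSet m ∩ bitSet n).Nonempty ↔ m &&& n ≠ 0 := by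
  rw [← not_iff_not, Finset.not_nonempty_iff_eq_empty, not_not, Finset.eq_empty_iff_forall_notMem]
  simp only [Finset.mem_inter, mem_bitSet]
  refine ⟨fun h => Nat.eq_of_testBit_eq fun i => ?_, fun h i => ?_⟩
  · simpa using h i
  · simpa using congrArg (Nat.testBit · i) h

/-- The number of members of a list of masks that share a one with the mask `m`.
It is phrased with the recursor and the binary natural number operations so that the kernel
evaluates it quickly. -/
def meetCount (m : ℕ) (l : List ℕ) : ℕ :=
  List.rec 0 (fun n _ k => Nat.add (bif Nat.beq (Nat.land m n) 0 then 0 else 1) k) l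

theorem meetCount_eq_countP (m : ℕ) (l : List ℕ) :
    meetCount m l = l.countP fun n => m &&& n ≠ 0 := by
  induction l with
  | nil => rfl
  | cons n l ih =>
    have h : meetCount m (n :: l) =
        (bif Nat.beq (m &&& n) 0 then 0 else 1) + meetCount m l := rfl
    rw [h, ih, List.countP_cons]
    by_cases hmn : m &&& n = 0
    · simp [hmn]
    · have hb : Nat.beq (m &&& n) 0 = false := by simpa [← Bool.not_eq_true] using hmn
      simp [hmn, hb, add_comm]

/-- The lines of `pgLines`, encoded as binary masks. -/
def pgMasks : List ℕ :=
  [313532678402, 2380206446260902707202, 283124378402818,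
   226678202863761406164994, 18031991786569730, 1218371705501873109729282,
   113346018960908474122276, 604611636681408870679556, 7157336700599322806276,
   412585316356, 4504716324110340, 3377700804755460,
   9042400823476488, 2436888679113326606827528, 1139094046474248,
   146700501000, 1190103223130489094152, 110716493239318216712,
   2254067690635536, 38369299730909938860048, 70371176906768,
   5207287069736976, 306953965501715019071504, 604760363555503229370384,
   277562392672, 2427298678038006870311072, 302268924852557016269344,
   1143560879480864, 4539333789089824, 632797108704532459684160,
   10996223575104, 9149036321835072, 4777706715090774396992,
   190075250935503221981248, 18626888058938590336, 151706311492563504269440,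
   9570698972369024, 18023263323046016, 70403647078528,
   604130868413988081920, 304592674173889137352960, 1185275364329893398016,
   1228110433451287242607104, 24189260009984, 457396839268864,
   15041823232, 844442110141440, 43285480448,
   70510511663104, 20270596370073600, 2418147940055942309130240,
   75558224013884514639872, 74507552235218829312, 1209075699410228067696640,
   1586715147260196408000512, 170005233933296328507392, 9481917217537920073728,
   2660947345028860084224, 605126992893035830837248, 1812698850553495552,
   2720673389944383524044800, 295580286203904131072, 18899266397587510394880,
   1209534563294980824104960, 2509045427151577284608, 10430477476625907712,
   4733895988191078383616, 37926658955530649731072, 2419050684349453206290432,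
   155839246891464580399104, 49584848637487864610816, 38110991270733982728192,
   151118609757943806033920, 23611905598426286391296, 2493483290074438382387200,
   1210180198774934975021056, 189079198292498186240, 907874974346774996582400,
   9449490033720627822592, 2413935172706631680, 680039220387253783101440]

/-- The masks of the lines through the point `p`. -/
def masksThrough (p : ℕ) : List ℕ :=
  pgMasks.filter fun n => n.testBit p

theorem pgMasks_nodup : pgMasks.Nodup := by
  decide +kernel

theorem pgLines_map_symm : pgLines.map bitSet.symm.toEmbedding = ⟨pgMasks, pgMasks_nodup⟩ := by
  decide +kernel

theorem pgLines_eq_map : pgLines = Finset.map bitSet.toEmbedding ⟨pgMasks, pgMasks_nodup⟩ := by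
  rw [← pgLines_map_symm, Finset.map_map]
  simp

theorem mem_pgLines {B : Finset ℕ} : B ∈ pgLines ↔ ∃ n ∈ pgMasks, bitSet n = B := by
  simp [pgLines_eq_map, ← Finset.mem_val, -Equiv.coe_toEmbedding, -Finset.mem_map_equiv]

theorem card_filter_pgLines (P : Finset ℕ → Prop) [DecidablePred P] :
    (pgLines.filter P).card = pgMasks.countP fun n => P (bitSet n) := by
  rw [pgLines_eq_map, Finset.filter_map, Finset.card_map, Finset.card_def, Finset.filter_val,
    ← Multiset.countP_eq_card_filter, Multiset.coe_countP]
  rfl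

theorem mem_range'_of_mem_pgPoints {p : ℕ} (hp : p ∈ pgPoints) : p ∈ List.range' 1 81 := by
  rw [pgPoints, Finset.mem_Icc] at hp
  rw [List.mem_range'_1]
  lia

theorem length_masksThrough {p : ℕ} (hp : p ∈ pgPoints) : (masksThrough p).length = 6 := by
  have h : ((List.range' 1 81).all fun p => (masksThrough p).length.beq 6) = true := by rfl
  exact Nat.eq_of_beq_eq_true (List.all_eq_true.1 h p (mem_range'_of_mem_pgPoints hp))

theorem land_eq_zero_or_two_pow {m n : ℕ} (hm : m ∈ pgMasks) (hn : n ∈ pgMasks) (hmn : m ≠ n) :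
    m &&& n = 0 ∨ m &&& n = 2 ^ (m &&& n).log2 := by
  have h : (pgMasks.all fun m => pgMasks.all fun n => Nat.beq m n || Nat.beq (Nat.land m n) 0 ||
      Nat.beq (Nat.land m n) (Nat.pow 2 (Nat.log2 (Nat.land m n)))) = true := by rfl
  have h' := List.all_eq_true.1 (List.all_eq_true.1 h m hm) n hn
  rw [Bool.or_eq_true, Bool.or_eq_true, Nat.beq_eq, Nat.beq_eq, Nat.beq_eq, or_assoc] at h'
  exact h'.resolve_left hmn

theorem meetCount_masksThrough {p m : ℕ} (hp : p ∈ pgPoints) (hm : m ∈ pgMasks)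
    (hpm : m.testBit p = false) : meetCount m (masksThrough p) = 2 := by
  have h : ((List.range' 1 81).all fun p => pgMasks.all fun m =>
      m.testBit p || Nat.beq (meetCount m (masksThrough p)) 2) = true := by rfl
  have h' := List.all_eq_true.1 (List.all_eq_true.1 h p (mem_range'_of_mem_pgPoints hp)) m hm
  rw [hpm, Bool.false_or] at h'
  exact Nat.eq_of_beq_eq_true h'

theorem eq_of_mem_of_mem {B C : Finset ℕ} (hB : B ∈ pgLines) (hC : C ∈ pgLines) {p q : ℕ}
    (hpq : p ≠ q) (hpB : p ∈ B) (hqB : q ∈ B) (hpC : p ∈ C) (hqC : q ∈ C) : B = C := by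
  obtain ⟨m, hm, rfl⟩ := mem_pgLines.1 hB
  obtain ⟨n, hn, rfl⟩ := mem_pgLines.1 hC
  rw [mem_bitSet] at hpB hqB hpC hqC
  by_contra hne
  have hp : (m &&& n).testBit p = true := by simp [hpB, hpC]
  have hq : (m &&& n).testBit q = true := by simp [hqB, hqC]
  rcases land_eq_zero_or_two_pow hm hn fun h => hne (congrArg _ h) with h | h
  · simp [h] at hp
  · rw [h, Nat.testBit_two_pow, decide_eq_true_eq] at hp hq
    exact hpq (hp.symm.trans hq)

/-- The incidence structure `(P, L)` with `P = {1,...,81}` and `L = pgLines`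
(incidence given by membership) is a partial geometry with parameters
`pg(5,5,2)`: there are 81 lines, each a 6-element subset of `P`; any two
distinct points lie in at most one common line; every point lies in exactly
6 lines; and for every point `p` and line `B` with `p ∉ B` there are exactly
2 lines containing `p` and meeting `B`. -/
theorem pgLines_isPartialGeometry_552 :
    pgLines.card = 81 ∧
    (∀ B ∈ pgLines, B ⊆ pgPoints ∧ B.card = 6) ∧
    (∀ p ∈ pgPoints, ∀ q ∈ pgPoints, p ≠ q →
      (pgLines.filter (fun B => p ∈ B ∧ q ∈ B)).card ≤ 1) ∧
    (∀ p ∈ pgPoints, (pgLines.filter (fun B => p ∈ B)).card = 6) ∧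
    (∀ p ∈ pgPoints, ∀ B ∈ pgLines, p ∉ B →
      (pgLines.filter (fun C => p ∈ C ∧ (B ∩ C).Nonempty)).card = 2) := by
  refine ⟨?_, by decide +kernel, fun p _ q _ hpq => ?_, fun p hp => ?_, fun p hp B hB hpB => ?_⟩
  · rw [pgLines_eq_map, Finset.card_map]
    rfl
  · refine Finset.card_le_one.2 fun B hB C hC => ?_
    rw [Finset.mem_filter] at hB hC
    exact eq_of_mem_of_mem hB.1 hC.1 hpq hB.2.1 hB.2.2 hC.2.1 hC.2.2
  · rw [card_filter_pgLines, ← length_masksThrough hp, masksThrough, ← List.countP_eq_length_filter]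
    simp [mem_bitSet]
  · obtain ⟨m, hm, rfl⟩ := mem_pgLines.1 hB
    rw [mem_bitSet, Bool.not_eq_true] at hpB
    rw [card_filter_pgLines, ← meetCount_masksThrough hp hm hpB, meetCount_eq_countP, masksThrough,
      List.countP_filter]
    simp [mem_bitSet, bitSet_inter_nonempty, Bool.and_comm]
end

section
/- The permutation f of P = {1,...,81} given in cycle notation by (1,4,3)(2,6,9,18,7,13)(5,20,10,21,11,12)(8,24,19,16,15,27)(14,17,23,26,22,25)(28,29,32)(30,47,42,39,36,34)(31,33,35,46,37,38)(40,41,45,54,49,50)(43,48,51,53,44,52)(55,71,72,65,59,57)(56,67,77,68,63,73)(58,60,75,74,62,61)(64,78,66)(69,81,76,79,70,80) has order 6, maps every member of L to a member of L (hence is an automorphism of the incidence structure (P,L)), and the cyclic group generated by f partitions L into exactly 15 orbits, of which 3 have length 3 and 12 have length 6. -/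
/-- The permutation `f` of `{1,...,81}` given in cycle notation by
`(1,4,3)(2,6,9,18,7,13)(5,20,10,21,11,12)(8,24,19,16,15,27)(14,17,23,26,22,25)`
`(28,29,32)(30,47,42,39,36,34)(31,33,35,46,37,38)(40,41,45,54,49,50)`
`(43,48,51,53,44,52)(55,71,72,65,59,57)(56,67,77,68,63,73)(58,60,75,74,62,61)`
`(64,78,66)(69,81,76,79,70,80)`, written as a product of the cycles. -/
def pgPerm : Equiv.Perm ℕ :=
  ([1, 4, 3] : List ℕ).formPerm *
  ([2, 6, 9, 18, 7, 13] : List ℕ).formPerm *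
  ([5, 20, 10, 21, 11, 12] : List ℕ).formPerm *
  ([8, 24, 19, 16, 15, 27] : List ℕ).formPerm *
  ([14, 17, 23, 26, 22, 25] : List ℕ).formPerm *
  ([28, 29, 32] : List ℕ).formPerm *
  ([30, 47, 42, 39, 36, 34] : List ℕ).formPerm *
  ([31, 33, 35, 46, 37, 38] : List ℕ).formPerm *
  ([40, 41, 45, 54, 49, 50] : List ℕ).formPerm *
  ([43, 48, 51, 53, 44, 52] : List ℕ).formPerm *
  ([55, 71, 72, 65, 59, 57] : List ℕ).formPerm *
  ([56, 67, 77, 68, 63, 73] : List ℕ).formPerm *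
  ([58, 60, 75, 74, 62, 61] : List ℕ).formPerm *
  ([64, 78, 66] : List ℕ).formPerm *
  ([69, 81, 76, 79, 70, 80] : List ℕ).formPerm

/-- The orbit of a line `B` under the cyclic group generated by `pgPerm`,
acting on lines by `B ↦ B.image pgPerm`. -/
def pgLineOrbit (B : Finset ℕ) : Set (Finset ℕ) :=
  {C : Finset ℕ | ∃ k : ℕ, C = (fun D : Finset ℕ => D.image pgPerm)^[k] B}

theorem pgPerm_apply_of_lt {n : ℕ} (hn : 81 < n) : pgPerm n = n := by
  have h (l : List ℕ) (hl : ∀ x ∈ l, x ≤ 81) : l.formPerm n = n :=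
    List.formPerm_apply_of_notMem fun hnl => absurd (hl n hnl) (by omega)
  simp only [pgPerm, Equiv.Perm.mul_apply]
  iterate 15 rw [h _ (by decide)]

theorem pgPerm_pow_six : pgPerm ^ 6 = 1 := by
  ext n
  by_cases hn : n < 82
  · have h : ∀ m < 82, (pgPerm ^ 6) m = m := by decide +kernel
    exact h n hn
  · have h : pgPerm n = n := pgPerm_apply_of_lt (by omega)
    exact Equiv.Perm.pow_apply_eq_self_of_apply_eq_self h 6

theorem orderOf_pgPerm : orderOf pgPerm = 6 := by
  rw [orderOf_eq_iff (by norm_num)]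
  refine ⟨pgPerm_pow_six, fun m hm hpos h => ?_⟩
  have h2 : ∀ k < 6, 0 < k → (pgPerm ^ k) 2 ≠ 2 := by decide +kernel
  exact h2 m hm hpos (by rw [h]; rfl)

theorem image_pgPerm_mem_pgLines : ∀ B ∈ pgLines, B.image pgPerm ∈ pgLines := by
  decide +kernel

theorem iterate_image_pgPerm (k : ℕ) (B : Finset ℕ) :
    (fun D : Finset ℕ => D.image pgPerm)^[k] B = B.image (pgPerm ^ k : Equiv.Perm ℕ) := by
  induction k with
  | zero => simp
  | succ k ih =>
    rw [Function.iterate_succ_apply', ih, Finset.image_image, pow_succ', Equiv.Perm.coe_mul]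

/-- The orbit of a line under `pgPerm`, as a finite set. -/
def pgLineOrbitFinset (B : Finset ℕ) : Finset (Finset ℕ) :=
  (Finset.range 6).image fun k => (fun D : Finset ℕ => D.image pgPerm)^[k] B

theorem coe_pgLineOrbitFinset (B : Finset ℕ) :
    (pgLineOrbitFinset B : Set (Finset ℕ)) = pgLineOrbit B := by
  ext C
  simp only [pgLineOrbitFinset, pgLineOrbit, Finset.coe_image, Set.mem_image, Finset.coe_range,
    Set.mem_Iio, Set.mem_ofPred_eq, iterate_image_pgPerm]
  constructor
  · rintro ⟨k, -, rfl⟩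
    exact ⟨k, rfl⟩
  · rintro ⟨k, rfl⟩
    refine ⟨k % 6, Nat.mod_lt _ (by norm_num), ?_⟩
    rw [← pow_mod_orderOf pgPerm k, orderOf_pgPerm]

/-- The orbits of `pgPerm` on the set of lines. -/
def pgOrbits : Finset (Finset (Finset ℕ)) := pgLines.image pgLineOrbitFinset

theorem setOf_pgLineOrbit_eq :
    {O : Set (Finset ℕ) | ∃ B ∈ pgLines, O = pgLineOrbit B} =
      (fun O : Finset (Finset ℕ) => (O : Set (Finset ℕ))) '' pgOrbits := by
  ext O
  simp [pgOrbits, coe_pgLineOrbitFinset, eq_comm]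

theorem setOf_pgLineOrbit_ncard_eq (m : ℕ) :
    {O : Set (Finset ℕ) | (∃ B ∈ pgLines, O = pgLineOrbit B) ∧ O.ncard = m} =
      (fun O : Finset (Finset ℕ) => (O : Set (Finset ℕ))) ''
        (pgOrbits.filter fun O => O.card = m) := by
  ext O
  simp only [pgOrbits, ← coe_pgLineOrbitFinset, Finset.coe_filter, Finset.mem_image,
    Set.mem_image, Set.mem_ofPred_eq]
  constructor
  · rintro ⟨⟨B, hB, rfl⟩, h⟩
    exact ⟨_, ⟨⟨B, hB, rfl⟩, by rwa [Set.ncard_coe_finset] at h⟩, rfl⟩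
  · rintro ⟨_, ⟨⟨B, hB, rfl⟩, h⟩, rfl⟩
    exact ⟨⟨B, hB, rfl⟩, by rwa [Set.ncard_coe_finset]⟩

theorem card_pgOrbits : pgOrbits.card = 15 ∧ (pgOrbits.filter fun O => O.card = 3).card = 3 ∧
    (pgOrbits.filter fun O => O.card = 6).card = 12 := by
  decide +kernel

/-- The permutation `pgPerm` has order 6, maps every line of `pgLines` to a line
of `pgLines` (hence is an automorphism of the incidence structure `(P, L)`), and
the cyclic group it generates partitions the set of lines into exactly 15
orbits, of which 3 have length 3 and 12 have length 6. -/
theorem pgPerm_props :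
    orderOf pgPerm = 6 ∧
    (∀ B ∈ pgLines, B.image pgPerm ∈ pgLines) ∧
    {O : Set (Finset ℕ) | ∃ B ∈ pgLines, O = pgLineOrbit B}.ncard = 15 ∧
    {O : Set (Finset ℕ) | (∃ B ∈ pgLines, O = pgLineOrbit B) ∧ O.ncard = 3}.ncard = 3 ∧
    {O : Set (Finset ℕ) | (∃ B ∈ pgLines, O = pgLineOrbit B) ∧ O.ncard = 6}.ncard = 12 := by
  refine ⟨orderOf_pgPerm, image_pgPerm_mem_pgLines, ?_, ?_, ?_⟩
  · rw [setOf_pgLineOrbit_eq, Set.ncard_image_of_injective _ Finset.coe_injective,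
      Set.ncard_coe_finset, card_pgOrbits.1]
  · rw [setOf_pgLineOrbit_ncard_eq, Set.ncard_image_of_injective _ Finset.coe_injective,
      Set.ncard_coe_finset, card_pgOrbits.2.1]
  · rw [setOf_pgLineOrbit_ncard_eq, Set.ncard_image_of_injective _ Finset.coe_injective,
      Set.ncard_coe_finset, card_pgOrbits.2.2]
end

section
/- The full automorphism group of the incidence structure (P,L) — the group of all permutations g of P such that g(B) ∈ L for every B ∈ L — has order exactly 972. -/
/-- An automorphism of the incidence structure `(P, L)`: a permutation of the
point set `P = {1,...,81}` (encoded as a permutation of `ℕ` fixing every point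
outside `P`) mapping every member of `pgLines` to a member of `pgLines`. -/
def IsAut (g : Equiv.Perm ℕ) : Prop :=
  (∀ x ∉ pgPoints, g x = x) ∧ ∀ B ∈ pgLines, B.image g ∈ pgLines

namespace PartialGeometry

open Equiv MulAction

/-- The automorphism group of the geometry, as a subgroup of the permutations of `ℕ`. -/
def autGroup : Subgroup (Perm ℕ) where
  carrier := {g | IsAut g}
  one_mem' := ⟨fun _ _ => rfl, fun B hB => by simpa using hB⟩
  mul_mem' := by
    rintro g h ⟨hg, hgL⟩ ⟨hh, hhL⟩
    refine ⟨fun x hx => by simp [hh x hx, hg x hx], fun B hB => ?_⟩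
    simpa [Finset.image_image] using hgL _ (hhL B hB)
  inv_mem' := by
    rintro g ⟨hg, hgL⟩
    refine ⟨fun x hx => Perm.inv_eq_iff_eq.2 (hg x hx).symm, fun B hB => ?_⟩
    obtain ⟨C, hC, rfl⟩ := Finset.surj_on_of_inj_on_of_card_le
      (fun C (_ : C ∈ pgLines) => C.image g) hgL
      (fun _ _ _ _ h => Finset.image_injective g.injective h) le_rfl B hB
    simpa [Finset.image_image] using hC

theorem apply_mem_points {g : Perm ℕ} (hg : g ∈ autGroup) {x : ℕ} :
    g x ∈ pgPoints ↔ x ∈ pgPoints := by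
  refine ⟨fun h => by_contra fun hx => hx (hg.1 x hx ▸ h), fun h => by_contra fun hx => hx ?_⟩
  rwa [g.injective (hg.1 _ hx)]

/-- For `x ≤ 81`, the set of points equal or collinear to `x`, as a bit mask. -/
def neighbourMask : List ℕ :=
  [0, 1447430133127325116252418, 725115000225746381790244, 2438189509011337984590088,
   950083636319854124581136, 2842913627534644591665892, 827650075515436563864928,
   2579023644082995255663776, 937993925043617631908186, 1531564634149775293373984,
   605815539789279321859780, 1386974111134593273244356, 2423529787234747889284036,
   2798298840302229462367520, 2477638203771570195944094, 2608297700036270351560794,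
   1058586879373224039780286, 2970520868594119074016378, 1209754362640850717941024,
   1289411653378628910919770, 708429862798646876890052, 1703743628425121707647940,
   1526515778826027828122270, 831549295860918730756766, 2435641317247699789582270,
   1256851726346862723361914, 608330683517534772423802, 1341475081837592753770430,
   1766202298481856362107924, 607789753007740470034664, 2739868258048858384761926,
   1212054039270262071001712, 2461711239363992545733378, 2926097485473498047186440,
   1398764178715131971249420, 2555206187014187318052226, 1366208546285240349385136,
   1068443074208822033152012, 1210478192995940876636518, 933995939762761221050530,
   2720864897009228195072070, 2647110947537791823648592, 729626504371803798346248,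
   1594110009722789474452680, 813058904893643804914210, 836174061428131859022632,
   699127565842575406442640, 2502943224695668425181776, 619342806276353273554434,
   1278664326617688735167632, 1242595958957983934816300, 2428534428909207476898068,
   2591716857361117440966708, 1624643601640717455202760, 945996362348844537497730,
   474739915757147960386952, 138728571053603703776784, 354718108641523978896528,
   240739740508591150934152, 474740445401673490612770, 4396977007699493015106566,
   4396978131469999689957552, 240744067243455136798466, 138737729055523892105516,
   4315708774360729881433282, 354754868306714414355048, 4315764107607008857065484,
   4290462929022989888341004, 4290610516438802763921936, 4723063209172494081939856,
   4723653528890539725850184, 357079142523243551811846, 479462224981138835380308,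
   4299760083304462400094690, 4415865297541063530138440, 278518409176288323485812,
   4798030784930871351320614, 289844218615389613164738, 4617921801561229632938800,
   1012895747531936233489748, 1617358649620354753628674, 2826284465429259151929512]

/-- The points `x` and `y` lie on a common line (this includes the case `x = y`). -/
def coll (x y : ℕ) : Bool := (neighbourMask.getD x 0).testBit y

theorem biUnion_lines_eq : ∀ x ∈ pgPoints,
    (pgLines.filter (x ∈ ·)).biUnion id = pgPoints.filter (coll x · = true) := by
  decide +kernel

theorem coll_iff {x y : ℕ} (hx : x ∈ pgPoints) (hy : y ∈ pgPoints) :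
    coll x y = true ↔ ∃ B ∈ pgLines, x ∈ B ∧ y ∈ B := by
  simpa [hy, and_assoc] using (Finset.ext_iff.1 (biUnion_lines_eq x hx) y).symm

theorem coll_apply {g : Perm ℕ} (hg : g ∈ autGroup) {x y : ℕ} (hx : x ∈ pgPoints)
    (hy : y ∈ pgPoints) : coll (g x) (g y) = coll x y := by
  have key : ∀ {g : Perm ℕ}, g ∈ autGroup → ∀ {x y}, x ∈ pgPoints → y ∈ pgPoints →
      coll x y = true → coll (g x) (g y) = true := by
    intro g hg x y hx hy h
    obtain ⟨B, hB, hxB, hyB⟩ := (coll_iff hx hy).1 h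
    exact (coll_iff ((apply_mem_points hg).2 hx) ((apply_mem_points hg).2 hy)).2
      ⟨B.image g, hg.2 B hB, Finset.mem_image_of_mem g hxB, Finset.mem_image_of_mem g hyB⟩
  rw [Bool.eq_iff_iff]
  refine ⟨fun h => ?_, key hg hx hy⟩
  simpa using key (inv_mem hg) ((apply_mem_points hg).2 hx) ((apply_mem_points hg).2 hy) h

/-- The points collinear to both `x` and `y`. -/
def commonNeighbours (x y : ℕ) : Finset ℕ :=
  pgPoints.filter fun z => coll x z = true ∧ coll y z = true

/-- The number of ordered pairs of collinear points among the common neighbours of `x` and `y`. -/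
def commonPairs (x y : ℕ) : ℕ :=
  ((commonNeighbours x y ×ˢ commonNeighbours x y).filter fun e => coll e.1 e.2 = true).card

theorem apply_mem_commonNeighbours {g : Perm ℕ} (hg : g ∈ autGroup) {x y : ℕ}
    (hx : x ∈ pgPoints) (hy : y ∈ pgPoints) {z : ℕ} :
    g z ∈ commonNeighbours (g x) (g y) ↔ z ∈ commonNeighbours x y := by
  simp only [commonNeighbours, Finset.mem_filter, apply_mem_points hg]
  refine and_congr_right fun hz => ?_
  rw [coll_apply hg hx hz, coll_apply hg hy hz]

theorem commonPairs_apply {g : Perm ℕ} (hg : g ∈ autGroup) {x y : ℕ} (hx : x ∈ pgPoints)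
    (hy : y ∈ pgPoints) : commonPairs (g x) (g y) = commonPairs x y := by
  symm
  refine Finset.card_equiv (g.prodCongr g) fun ⟨z, w⟩ => ?_
  simp only [Finset.mem_filter, Finset.mem_product, prodCongr_apply, Prod.map,
    apply_mem_commonNeighbours hg hx hy]
  refine and_congr_right fun ⟨hz, hw⟩ => ?_
  rw [coll_apply hg (Finset.mem_filter.1 hz).1 (Finset.mem_filter.1 hw).1]

/-- The values of `commonPairs 28`. -/
def pairCounts₂₈ : List ℕ :=
  [0, 50, 65, 42, 65, 42, 42, 42, 50, 50, 65, 50, 65, 50, 65, 65, 50, 42, 65, 42, 50, 42, 42, 50,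
   65, 50, 65, 42, 361, 48, 42, 67, 48, 67, 42, 67, 42, 67, 67, 42, 42, 42, 42, 67, 67, 42, 67, 42,
   67, 42, 42, 67, 67, 67, 42, 65, 50, 42, 65, 50, 50, 42, 50, 42, 42, 65, 50, 42, 50, 50, 42, 50,
   42, 65, 65, 42, 65, 65, 65, 50, 65, 42]

/-- The values of `commonPairs 1`. -/
def pairCounts₁ : List ℕ :=
  [0, 361, 42, 48, 48, 36, 42, 42, 73, 42, 36, 36, 36, 42, 67, 73, 73, 67, 42, 73, 36, 36, 67, 67,
   73, 67, 67, 73, 50, 42, 65, 50, 65, 42, 42, 65, 50, 42, 65, 65, 65, 50, 42, 42, 65, 42, 50, 50,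
   65, 50, 42, 50, 50, 42, 65, 40, 44, 44, 40, 73, 73, 44, 73, 40, 73, 40, 40, 40, 44, 44, 40, 73,
   44, 73, 40, 44, 73, 73, 44, 44, 73, 40]

theorem commonPairs_twentyEight : ∀ y ∈ pgPoints, commonPairs 28 y = pairCounts₂₈.getD y 0 := by
  decide +kernel

theorem commonPairs_one : ∀ y ∈ pgPoints, commonPairs 1 y = pairCounts₁.getD y 0 := by
  decide +kernel

/-- Pairs of non-collinear points with `commonPairs` equal to `36`, covering all points outside
`{28, ..., 54}`. -/
def sparsePairs : List (ℕ × ℕ) :=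
  [(1, 5), (1, 12), (1, 20), (1, 21), (2, 8), (2, 26), (3, 10), (4, 11), (6, 14), (6, 27), (7,
   15), (9, 17), (13, 16), (18, 22), (19, 25), (23, 24), (55, 67), (55, 76), (56, 57), (56, 79),
   (56, 80), (56, 81), (58, 60), (58, 78), (59, 68), (61, 62), (63, 65), (64, 74), (66, 75), (69,
   72), (70, 73), (71, 77)]

theorem sparsePairs_spec : ∀ e ∈ sparsePairs,
    (e.1 ∈ pgPoints ∧ e.2 ∈ pgPoints) ∧ (coll e.1 e.2 = false ∧ commonPairs e.1 e.2 = 36) ∧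
      coll e.2 e.1 = false ∧ commonPairs e.2 e.1 = 36 := by
  decide +kernel

theorem sparsePairs_cover : ∀ x ∈ pgPoints, x ∉ Finset.Icc 28 54 →
    ∃ e ∈ sparsePairs, x = e.1 ∨ x = e.2 := by
  decide +kernel

theorem not_sparse_twentyEight : ∀ y ∈ pgPoints,
    ¬ (coll 28 y = false ∧ pairCounts₂₈.getD y 0 = 36) := by
  decide +kernel

theorem apply_twentyEight_mem {g : Perm ℕ} (hg : g ∈ autGroup) : g 28 ∈ Finset.Icc 28 54 := by
  by_contra hx
  have h28 : 28 ∈ pgPoints := by decide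
  have key : ∀ y ∈ pgPoints, ¬ (coll (g 28) y = false ∧ commonPairs (g 28) y = 36) := by
    intro y hy ⟨h₁, h₂⟩
    have hz : g⁻¹ y ∈ pgPoints := (apply_mem_points (inv_mem hg)).2 hy
    rw [← show g (g⁻¹ y) = y from g.apply_symm_apply y] at h₁ h₂
    rw [coll_apply hg h28 hz] at h₁
    rw [commonPairs_apply hg h28 hz, commonPairs_twentyEight _ hz] at h₂
    exact not_sparse_twentyEight _ hz ⟨h₁, h₂⟩
  obtain ⟨e, he, h | h⟩ := sparsePairs_cover _ ((apply_mem_points hg).2 h28) hx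
  · exact key e.2 (sparsePairs_spec e he).1.2 (h ▸ (sparsePairs_spec e he).2.1)
  · exact key e.1 (sparsePairs_spec e he).1.1 (h ▸ (sparsePairs_spec e he).2.2)

theorem coll_apply_of_fixed {g : Perm ℕ} (hg : g ∈ autGroup) {p x : ℕ} (hp : p ∈ pgPoints)
    (hx : x ∈ pgPoints) (h : g p = p) : coll p (g x) = coll p x := by
  simpa [h] using coll_apply hg hp hx

theorem pairCounts₂₈_apply {g : Perm ℕ} (hg : g ∈ autGroup) {x : ℕ} (hx : x ∈ pgPoints)
    (h : g 28 = 28) : pairCounts₂₈.getD (g x) 0 = pairCounts₂₈.getD x 0 := by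
  have := commonPairs_apply hg (by decide : 28 ∈ pgPoints) hx
  rwa [h, commonPairs_twentyEight _ ((apply_mem_points hg).2 hx),
    commonPairs_twentyEight _ hx] at this

theorem pairCounts₁_apply {g : Perm ℕ} (hg : g ∈ autGroup) {x : ℕ} (hx : x ∈ pgPoints)
    (h : g 1 = 1) : pairCounts₁.getD (g x) 0 = pairCounts₁.getD x 0 := by
  have := commonPairs_apply hg (by decide : 1 ∈ pgPoints) hx
  rwa [h, commonPairs_one _ ((apply_mem_points hg).2 hx), commonPairs_one _ hx] at this

/-- The orbit of the point `1` under the stabilizer of `28`. -/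
def orbitOne : Finset ℕ := pgPoints.filter fun y => pairCounts₂₈.getD y 0 = 50

theorem apply_one_mem {g : Perm ℕ} (hg : g ∈ autGroup) (h : g 28 = 28) : g 1 ∈ orbitOne := by
  have h1 : 1 ∈ pgPoints := by decide
  exact Finset.mem_filter.2 ⟨(apply_mem_points hg).2 h1, by
    rw [pairCounts₂₈_apply hg h1 h]; decide⟩

/-- The isomorphism invariants of `x` relative to the points `28` and `1`. -/
def invariants (x : ℕ) : Bool × Bool × ℕ × ℕ :=
  (coll 28 x, coll 1 x, pairCounts₂₈.getD x 0, pairCounts₁.getD x 0)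

theorem invariants_apply {g : Perm ℕ} (hg : g ∈ autGroup) (h₂₈ : g 28 = 28) (h₁ : g 1 = 1)
    {x : ℕ} (hx : x ∈ pgPoints) : invariants (g x) = invariants x := by
  simp only [invariants, coll_apply_of_fixed hg (by decide : 28 ∈ pgPoints) hx h₂₈,
    coll_apply_of_fixed hg (by decide : 1 ∈ pgPoints) hx h₁, pairCounts₂₈_apply hg hx h₂₈,
    pairCounts₁_apply hg hx h₁]

theorem apply_two_mem {g : Perm ℕ} (hg : g ∈ autGroup) (h₂₈ : g 28 = 28) (h₁ : g 1 = 1) :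
    g 2 ∈ ({2, 18} : Finset ℕ) := by
  have key : ∀ y ∈ pgPoints, invariants y = invariants 2 → y ∈ ({2, 18} : Finset ℕ) := by
    decide +kernel
  have h2 : 2 ∈ pgPoints := by decide
  exact key _ ((apply_mem_points hg).2 h2) (invariants_apply hg h₂₈ h₁ h2)

theorem eq_one_of_fixed {g : Perm ℕ} (hg : g ∈ autGroup) (h₂₈ : g 28 = 28) (h₁ : g 1 = 1)
    (h₂ : g 2 = 2) : g = 1 := by
  have step : ∀ x ∈ [14, 18, 22, 27], ∀ y ∈ pgPoints,
      invariants y = invariants x → coll 2 y = coll 2 x → y = x := by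
    decide +kernel
  have separate : ∀ x ∈ pgPoints, ∀ y ∈ pgPoints, invariants y = invariants x →
      (∀ p ∈ [2, 14, 18, 22, 27], coll p y = coll p x) → y = x := by
    decide +kernel
  have points : ∀ p ∈ [2, 14, 18, 22, 27], p ∈ pgPoints := by decide
  have fixed : ∀ p ∈ [2, 14, 18, 22, 27], g p = p := by
    intro p hp
    have hpP := points p hp
    rcases List.mem_cons.1 hp with rfl | hp'
    · exact h₂
    · exact step p hp' _ ((apply_mem_points hg).2 hpP) (invariants_apply hg h₂₈ h₁ hpP)
        (coll_apply_of_fixed hg (points 2 (by simp)) hpP h₂)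
  ext x
  by_cases hx : x ∈ pgPoints
  · exact separate x hx _ ((apply_mem_points hg).2 hx) (invariants_apply hg h₂₈ h₁ hx)
      fun p hp => coll_apply_of_fixed hg (points p hp) hx (fixed p hp)
  · exact hg.1 x hx

/-- The self-map of `ℕ` with the given initial values, fixing all further numbers. -/
def tableMap (t : List ℕ) (x : ℕ) : ℕ := t.getD x x

theorem exists_mem_autGroup {t : List ℕ} (n : ℕ) (hlen : t.length = 82) (hzero : tableMap t 0 = 0)
    (hiter : ∀ x ∈ pgPoints, (tableMap t)^[n + 1] x = x)
    (hlines : ∀ B ∈ pgLines, B.image (tableMap t) ∈ pgLines) :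
    ∃ g ∈ autGroup, ⇑g = tableMap t := by
  have hout : ∀ x ∉ pgPoints, tableMap t x = x := by
    intro x hx
    rcases Nat.eq_zero_or_pos x with rfl | hpos
    · exact hzero
    · exact List.getD_eq_default _ _ (by simp only [pgPoints, Finset.mem_Icc] at hx; omega)
  have hid : (tableMap t)^[n + 1] = id := by
    funext x
    by_cases hx : x ∈ pgPoints
    · exact hiter x hx
    · exact Function.iterate_fixed (hout x hx) _
  have hbij : Function.Bijective (tableMap t) :=
    ⟨.of_comp (f := (tableMap t)^[n]) (by rw [← Function.iterate_succ, hid]; exact fun _ _ h => h),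
      .of_comp (g := (tableMap t)^[n])
        (by rw [← Function.iterate_succ', hid]; exact fun x => ⟨x, rfl⟩)⟩
  exact ⟨.ofBijective _ hbij, ⟨hout, hlines⟩, rfl⟩

/-- An automorphism of order 4 fixing the point `28`. -/
def quarterTurn : List ℕ :=
  [0, 66, 73, 64, 78, 61, 63, 67, 69, 68, 74, 60, 58, 56, 65, 76, 79, 72, 77, 70, 62, 75, 57, 71,
   80, 59, 55, 81, 28, 32, 49, 43, 29, 52, 50, 44, 40, 51, 48, 41, 47, 30, 45, 46, 38, 34, 53, 54,
   35, 39, 42, 33, 37, 31, 36, 14, 9, 17, 10, 23, 20, 21, 11, 7, 3, 26, 1, 6, 13, 16, 27, 25, 22,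
   18, 12, 5, 24, 2, 4, 8, 15, 19]

/-- An automorphism of order 3 fixing the point `28`. -/
def thirdTurn : List ℕ :=
  [0, 8, 14, 19, 15, 17, 5, 22, 16, 23, 26, 25, 2, 11, 12, 24, 1, 6, 10, 27, 9, 7, 21, 20, 4, 13,
   18, 3, 28, 29, 36, 31, 32, 33, 47, 35, 42, 37, 38, 34, 45, 50, 30, 44, 51, 49, 46, 39, 53, 40,
   54, 43, 48, 52, 41, 58, 68, 70, 80, 62, 71, 57, 79, 67, 63, 76, 56, 64, 66, 60, 61, 69, 75, 78,
   65, 81, 74, 73, 77, 59, 55, 72]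

/-- An automorphism of order 3 moving the point `28`. -/
def shift : List ℕ :=
  [0, 1, 2, 3, 4, 10, 6, 7, 19, 9, 11, 5, 21, 13, 23, 8, 24, 25, 18, 15, 12, 20, 14, 22, 27, 26,
   17, 16, 51, 43, 40, 41, 44, 42, 37, 54, 49, 50, 30, 35, 38, 47, 45, 53, 48, 33, 36, 31, 32, 46,
   34, 52, 28, 29, 39, 58, 68, 69, 81, 62, 71, 57, 80, 67, 77, 70, 63, 66, 78, 61, 74, 76, 75, 64,
   65, 79, 60, 73, 56, 72, 59, 55]

theorem exists_quarterTurn : ∃ g ∈ autGroup, ⇑g = tableMap quarterTurn :=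
  exists_mem_autGroup 3 (by decide) (by decide) (by decide +kernel) (by decide +kernel)

theorem exists_thirdTurn : ∃ g ∈ autGroup, ⇑g = tableMap thirdTurn :=
  exists_mem_autGroup 2 (by decide) (by decide) (by decide +kernel) (by decide +kernel)

theorem exists_shift : ∃ g ∈ autGroup, ⇑g = tableMap shift :=
  exists_mem_autGroup 2 (by decide) (by decide) (by decide +kernel) (by decide +kernel)

theorem exists_apply_twentyEight : ∀ y ∈ Finset.Icc 28 54, ∃ g ∈ autGroup, g 28 = y := by
  have key : ∀ y ∈ Finset.Icc 28 54, ∃ i < 3, ∃ j < 4, ∃ k < 3, ∃ l < 3,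
      (tableMap shift)^[i] ((tableMap quarterTurn)^[j] ((tableMap thirdTurn)^[k]
        ((tableMap shift)^[l] 28))) = y := by
    decide +kernel
  obtain ⟨d, hd, hd'⟩ := exists_quarterTurn
  obtain ⟨p, hp, hp'⟩ := exists_thirdTurn
  obtain ⟨r, hr, hr'⟩ := exists_shift
  intro y hy
  obtain ⟨i, -, j, -, k, -, l, -, h⟩ := key y hy
  refine ⟨r ^ i * d ^ j * p ^ k * r ^ l, mul_mem (mul_mem (mul_mem (pow_mem hr i)
    (pow_mem hd j)) (pow_mem hp k)) (pow_mem hr l), ?_⟩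
  simpa only [← hd', ← hp', ← hr', Perm.iterate_eq_pow, Perm.mul_apply] using h

theorem exists_apply_one : ∀ y ∈ orbitOne,
    ∃ g ∈ autGroup ⊓ stabilizer (Perm ℕ) 28, g 1 = y := by
  have key : ∀ y ∈ orbitOne, ∃ i < 4, ∃ j < 3, ∃ k < 4, ∃ l < 3,
      (tableMap quarterTurn)^[i] ((tableMap thirdTurn)^[j] ((tableMap quarterTurn)^[k]
        ((tableMap thirdTurn)^[l] 1))) = y := by
    decide +kernel
  obtain ⟨d, hd, hd'⟩ := exists_quarterTurn
  obtain ⟨p, hp, hp'⟩ := exists_thirdTurn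
  have hd₂₈ : d ∈ autGroup ⊓ stabilizer (Perm ℕ) 28 :=
    ⟨hd, (congrFun hd' 28).trans (by decide)⟩
  have hp₂₈ : p ∈ autGroup ⊓ stabilizer (Perm ℕ) 28 :=
    ⟨hp, (congrFun hp' 28).trans (by decide)⟩
  intro y hy
  obtain ⟨i, -, j, -, k, -, l, -, h⟩ := key y hy
  refine ⟨d ^ i * p ^ j * d ^ k * p ^ l, mul_mem (mul_mem (mul_mem (pow_mem hd₂₈ i)
    (pow_mem hp₂₈ j)) (pow_mem hd₂₈ k)) (pow_mem hp₂₈ l), ?_⟩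
  simpa only [← hd', ← hp', Perm.iterate_eq_pow, Perm.mul_apply] using h

theorem exists_apply_two : ∀ y ∈ ({2, 18} : Finset ℕ),
    ∃ g ∈ autGroup ⊓ stabilizer (Perm ℕ) 28 ⊓ stabilizer (Perm ℕ) 1, g 2 = y := by
  obtain ⟨d, hd, hd'⟩ := exists_quarterTurn
  intro y hy
  simp only [Finset.mem_insert, Finset.mem_singleton] at hy
  rcases hy with rfl | rfl
  · exact ⟨1, one_mem _, rfl⟩
  · refine ⟨d * d, ⟨⟨mul_mem hd hd, ?_⟩, ?_⟩, ?_⟩ <;>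
      simp [mem_stabilizer_iff, hd'] <;> decide

theorem card_eq_mul_card_stabilizer (H : Subgroup (Perm ℕ)) (p : ℕ) (O : Finset ℕ)
    (hmem : ∀ g ∈ H, g p ∈ O) (hex : ∀ y ∈ O, ∃ g ∈ H, g p = y) :
    Nat.card H = O.card * Nat.card ↥(H ⊓ stabilizer (Perm ℕ) p) := by
  have horbit : orbit H p = ↑O := by
    ext y
    constructor
    · rintro ⟨g, rfl⟩
      exact hmem g g.2
    · intro hy
      obtain ⟨g, hg, rfl⟩ := hex y hy
      exact ⟨⟨g, hg⟩, rfl⟩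
  have hstab : Nat.card (stabilizer H p) = Nat.card ↥(H ⊓ stabilizer (Perm ℕ) p) := by
    have : (stabilizer H p) = (stabilizer (Perm ℕ) p).subgroupOf H := rfl
    rw [this, ← Subgroup.inf_subgroupOf_left]
    exact Nat.card_congr (Subgroup.subgroupOfEquivOfLe inf_le_left).toEquiv
  rw [← (stabilizer H p).index_mul_card, index_stabilizer, horbit, Set.ncard_coe_finset, hstab]

theorem card_autGroup : Nat.card autGroup = 972 := by
  have hbot : autGroup ⊓ stabilizer (Perm ℕ) 28 ⊓ stabilizer (Perm ℕ) 1 ⊓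
      stabilizer (Perm ℕ) 2 = ⊥ :=
    (Subgroup.eq_bot_iff_forall _).2 fun _ ⟨⟨⟨hg, h₂₈⟩, h₁⟩, h₂⟩ => eq_one_of_fixed hg h₂₈ h₁ h₂
  rw [card_eq_mul_card_stabilizer autGroup 28 _ (fun _ hg => apply_twentyEight_mem hg)
      exists_apply_twentyEight,
    card_eq_mul_card_stabilizer (autGroup ⊓ stabilizer (Perm ℕ) 28) 1 orbitOne
      (fun _ hg => apply_one_mem hg.1 hg.2) exists_apply_one,
    card_eq_mul_card_stabilizer (autGroup ⊓ stabilizer (Perm ℕ) 28 ⊓ stabilizer (Perm ℕ) 1) 2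
      {2, 18} (fun _ hg => apply_two_mem hg.1.1 hg.1.2 hg.2) exists_apply_two, hbot, Subgroup.card_bot]
  decide +kernel

end PartialGeometry

/-- The full automorphism group of the incidence structure `(P, L)`, i.e. the
group of all permutations `g` of `P` with `g(B) ∈ L` for every `B ∈ L`, has
order exactly 972. -/
theorem card_aut_eq_972 : Nat.card {g : Equiv.Perm ℕ // IsAut g} = 972 := by
  exact PartialGeometry.card_autGroup
end

section
/- The full automorphism group of the incidence structure (P,L) partitions the point set P into exactly two orbits, of sizes 54 and 27, and partitions the line set L into exactly two orbits, of sizes 54 and 27; in particular, the automorphism group is not transitive on P. -/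
/-- The orbit of a point `x` under the full automorphism group of `(P, L)`. -/
def pointOrbit (x : ℕ) : Set ℕ :=
  {y : ℕ | ∃ g : Equiv.Perm ℕ, IsAut g ∧ g x = y}

/-- The orbit of a line `B` under the full automorphism group of `(P, L)`. -/
def lineOrbit (B : Finset ℕ) : Set (Finset ℕ) :=
  {C : Finset ℕ | ∃ g : Equiv.Perm ℕ, IsAut g ∧ B.image g = C}

open scoped Pointwise

/-- The full automorphism group of `(P, L)`. -/
def autGroup : Subgroup (Equiv.Perm ℕ) where
  carrier := {g | IsAut g}
  one_mem' := ⟨fun _ _ => rfl, fun B hB => by simpa using hB⟩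
  mul_mem' {g h} hg hh :=
    ⟨fun x hx => by rw [Equiv.Perm.mul_apply, hh.1 x hx, hg.1 x hx], fun B hB => by
      simpa [Finset.image_image] using hg.2 _ (hh.2 B hB)⟩
  inv_mem' {g} hg := by
    refine ⟨fun x hx => Equiv.Perm.inv_eq_iff_eq.2 (hg.1 x hx).symm, fun B hB => ?_⟩
    have himage : pgLines.image (Finset.image g) = pgLines :=
      Finset.eq_of_subset_of_card_le (Finset.image_subset_iff.2 hg.2)
        (Finset.card_image_of_injective _ (Finset.image_injective g.injective)).ge
    rw [← himage] at hB
    obtain ⟨C, hC, rfl⟩ := Finset.mem_image.1 hB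
    simpa [Finset.image_image] using hC

theorem mem_autGroup {g : Equiv.Perm ℕ} : g ∈ autGroup ↔ IsAut g := Iff.rfl

theorem pointOrbit_eq_orbit (x : ℕ) : pointOrbit x = MulAction.orbit autGroup x := by
  ext y
  simp [pointOrbit, MulAction.mem_orbit_iff, Subgroup.smul_def, mem_autGroup]

theorem lineOrbit_eq_orbit (B : Finset ℕ) : lineOrbit B = MulAction.orbit autGroup B := by
  ext C
  simp [lineOrbit, MulAction.mem_orbit_iff, Subgroup.smul_def, mem_autGroup, Finset.smul_finset_def]

theorem smul_mem_pgPoints (g : autGroup) {x : ℕ} (hx : x ∈ pgPoints) : g • x ∈ pgPoints := by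
  by_contra h
  have hfix : g • g • x = g • x := g.2.1 _ h
  exact h ((MulAction.injective g hfix).symm ▸ hx)

theorem smul_mem_pgLines (g : autGroup) {B : Finset ℕ} (hB : B ∈ pgLines) : g • B ∈ pgLines :=
  g.2.2 B hB

/-- If an invariant finite set `U` is covered by two distinct orbits, the first of which contains
`S` and the second `U \ S`, then these are the only orbits on `U` and they have the expected
sizes. -/
theorem exists_two_orbits {G X : Type*} [Group G] [MulAction G X] [DecidableEq X]
    {U S : Finset X} {a b : X} (hU : ∀ g : G, ∀ x ∈ U, g • x ∈ U) (hSU : S ⊆ U)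
    (ha : a ∈ S) (hb : b ∈ U \ S) (hS : ∀ x ∈ S, x ∈ MulAction.orbit G a)
    (hT : ∀ x ∈ U \ S, x ∈ MulAction.orbit G b) (hab : b ∉ MulAction.orbit G a) :
    ∃ O₁ O₂ : Set X, O₁ ≠ O₂ ∧ O₁.ncard = S.card ∧ O₂.ncard = (U \ S).card ∧
      {O : Set X | ∃ x ∈ U, O = MulAction.orbit G x} = {O₁, O₂} := by
  have hne : MulAction.orbit G a ≠ MulAction.orbit G b := fun h =>
    hab (h ▸ MulAction.mem_orbit_self b)
  have horbit : ∀ x ∈ U, ∀ y ∈ MulAction.orbit G x, y ∈ U := by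
    rintro x hx _ ⟨g, rfl⟩
    exact hU g x hx
  have hOa : MulAction.orbit G a = S := by
    ext y
    refine ⟨fun hy => ?_, hS y⟩
    by_contra hyS
    have hyT := hT y (Finset.mem_sdiff.2 ⟨horbit a (hSU ha) y hy, hyS⟩)
    exact hne ((MulAction.orbit_eq_iff.2 hy).symm.trans (MulAction.orbit_eq_iff.2 hyT))
  have hOb : MulAction.orbit G b = ↑(U \ S) := by
    ext y
    refine ⟨fun hy => ?_, hT y⟩
    refine Finset.mem_sdiff.2 ⟨horbit b (Finset.mem_sdiff.1 hb).1 y hy, fun hyS => ?_⟩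
    exact hne ((MulAction.orbit_eq_iff.2 (hS y hyS)).symm.trans (MulAction.orbit_eq_iff.2 hy))
  refine ⟨_, _, hne, by rw [hOa, Set.ncard_coe_finset], by rw [hOb, Set.ncard_coe_finset], ?_⟩
  ext O
  constructor
  · rintro ⟨x, hx, rfl⟩
    by_cases hxS : x ∈ S
    · exact Or.inl (MulAction.orbit_eq_iff.2 (hS x hxS))
    · exact Or.inr (MulAction.orbit_eq_iff.2 (hT x (Finset.mem_sdiff.2 ⟨hx, hxS⟩)))
  · rintro (rfl | rfl)
    · exact ⟨a, hSU ha, rfl⟩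
    · exact ⟨b, (Finset.mem_sdiff.1 hb).1, rfl⟩

/-- Adjoin to a finite set its images under two group elements. -/
def orbitStep {G X : Type*} [Group G] [MulAction G X] [DecidableEq X] (g h : G) (A : Finset X) :
    Finset X :=
  A ∪ A.image (g • ·) ∪ A.image (h • ·)

theorem iterate_orbitStep_subset_orbit {G X : Type*} [Group G] [MulAction G X] [DecidableEq X]
    (H : Subgroup G) {g h : G} (hg : g ∈ H) (hh : h ∈ H) (a : X) (n : ℕ) :
    ∀ x ∈ (orbitStep g h)^[n] {a}, x ∈ MulAction.orbit H a := by
  induction n with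
  | zero => simp
  | succ n ih =>
    intro x hx
    rw [Function.iterate_succ_apply'] at hx
    simp only [orbitStep, Finset.mem_union, Finset.mem_image] at hx
    obtain (hx | ⟨y, hy, rfl⟩) | ⟨y, hy, rfl⟩ := hx
    · exact ih x hx
    · exact MulAction.mem_orbit_of_mem_orbit (⟨g, hg⟩ : H) (ih y hy)
    · exact MulAction.mem_orbit_of_mem_orbit (⟨h, hh⟩ : H) (ih y hy)

/-- An automorphism of order `3`. -/
def genA : Equiv.Perm ℕ :=
  ([[1, 22, 26], [2, 5, 16], [3, 14, 25], [4, 23, 17], [6, 19, 21], [7, 11, 24], [8, 20, 13],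
    [9, 10, 27], [12, 18, 15], [28, 39, 42], [29, 47, 30], [31, 49, 51], [32, 34, 36],
    [33, 48, 41], [35, 40, 44], [37, 45, 43], [38, 52, 50], [46, 53, 54], [55, 74, 56],
    [57, 68, 62], [58, 71, 73], [59, 60, 63], [61, 77, 72], [64, 80, 70], [65, 67, 75],
    [66, 81, 69], [76, 78, 79]].map List.formPerm).prod

/-- An automorphism of order `4`. -/
def genB : Equiv.Perm ℕ :=
  ([[1, 77, 7, 73], [2, 68, 3, 56], [4, 63, 9, 67], [5, 80, 17, 69], [6, 64], [8, 59, 21, 57],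
    [10, 79, 26, 70], [11, 81, 25, 76], [12, 65, 19, 72], [13, 66], [14, 75, 27, 74],
    [15, 55, 20, 71], [16, 61, 22, 62], [18, 78], [23, 58, 24, 60], [28, 54, 33, 39],
    [29, 50, 38, 34], [30, 45, 53, 51], [32, 41, 46, 47], [35, 37], [36, 49, 48, 44],
    [40, 52, 43, 42]].map List.formPerm).prod

/-- A product of cycles supported on `pgPoints` fixes every point outside `pgPoints`. -/
theorem prod_formPerm_apply_of_notMem {c : List (List ℕ)} (hc : ∀ l ∈ c, ∀ y ∈ l, y ∈ pgPoints)
    {x : ℕ} (hx : x ∉ pgPoints) : (c.map List.formPerm).prod x = x := by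
  induction c with
  | nil => rfl
  | cons l c ih =>
    rw [List.map_cons, List.prod_cons, Equiv.Perm.mul_apply,
      ih fun m hm => hc m (List.mem_cons_of_mem l hm),
      List.formPerm_apply_of_notMem fun h => hx (hc l List.mem_cons_self x h)]

theorem isAut_genA : IsAut genA :=
  ⟨fun _ => prod_formPerm_apply_of_notMem (by decide +kernel), by decide +kernel⟩

theorem isAut_genB : IsAut genB :=
  ⟨fun _ => prod_formPerm_apply_of_notMem (by decide +kernel), by decide +kernel⟩

/-- Five points, any two of which lie on a line that contains none of the other three. -/
def IsArc (f : Fin 5 → ℕ) : Prop :=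
  ∀ i j, i ≠ j → ∃ l ∈ pgLines, f i ∈ l ∧ f j ∈ l ∧ ∀ k, k ≠ i → k ≠ j → f k ∉ l

theorem IsArc.injective {f : Fin 5 → ℕ} (hf : IsArc f) : Function.Injective f := by
  intro i j hij
  by_contra hne
  obtain ⟨k, hki, hkj⟩ : ∃ k, k ≠ i ∧ k ≠ j := by
    clear hij
    revert i j
    decide
  obtain ⟨l, -, hi, -, hl⟩ := hf i k hki.symm
  exact hl j (Ne.symm hne) hkj.symm (hij ▸ hi)

theorem IsArc.comp_isAut {f : Fin 5 → ℕ} (hf : IsArc f) {g : Equiv.Perm ℕ} (hg : IsAut g) :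
    IsArc (g ∘ f) := by
  intro i j hij
  obtain ⟨l, hl, hi, hj, hk⟩ := hf i j hij
  exact ⟨l.image g, hg.2 l hl, Finset.mem_image_of_mem g hi, Finset.mem_image_of_mem g hj,
    fun k hki hkj => by simpa using hk k hki hkj⟩

theorem isArc_one : IsArc ![1, 8, 24, 62, 71] := by
  unfold IsArc
  decide +kernel

/-- The points on a line of `L` through `x`. -/
@[irreducible] def neighbors (L : Finset (Finset ℕ)) (x : ℕ) : Finset ℕ :=
  (L.filter (x ∈ ·)).biUnion id

theorem mem_neighbors {L : Finset (Finset ℕ)} {x y : ℕ} :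
    y ∈ neighbors L x ↔ ∃ l ∈ L, x ∈ l ∧ y ∈ l := by
  simp only [neighbors, Finset.mem_biUnion, Finset.mem_filter, id, and_assoc]

/-- The distinct points `a` and `b` lie on a common line that does not contain `x`. -/
def JoinedOff (x a b : ℕ) : Prop := a ≠ b ∧ ∃ l ∈ pgLines, a ∈ l ∧ b ∈ l ∧ x ∉ l

instance (x a b : ℕ) : Decidable (JoinedOff x a b) :=
  inferInstanceAs (Decidable (a ≠ b ∧ ∃ l ∈ pgLines, a ∈ l ∧ b ∈ l ∧ x ∉ l))

theorem no_four_joinedOff :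
    ∀ a ∈ neighbors pgLines 28, ∀ b ∈ neighbors pgLines 28, JoinedOff 28 a b →
    ∀ c ∈ neighbors pgLines 28, JoinedOff 28 a c → JoinedOff 28 b c →
    ∀ d ∈ neighbors pgLines 28, JoinedOff 28 a d → JoinedOff 28 b d → ¬ JoinedOff 28 c d := by
  decide +kernel

theorem IsArc.mem_neighbors {f : Fin 5 → ℕ} (hf : IsArc f) {i j : Fin 5} (hij : i ≠ j) :
    f j ∈ neighbors pgLines (f i) := by
  obtain ⟨l, hl, hi, hj, -⟩ := hf i j hij
  exact _root_.mem_neighbors.2 ⟨l, hl, hi, hj⟩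

theorem IsArc.joinedOff {f : Fin 5 → ℕ} (hf : IsArc f) {i j k : Fin 5} (hij : i ≠ j)
    (hki : k ≠ i) (hkj : k ≠ j) : JoinedOff (f k) (f i) (f j) := by
  obtain ⟨l, hl, hi, hj, hk⟩ := hf i j hij
  exact ⟨hf.injective.ne hij, l, hl, hi, hj, hk k hki hkj⟩

theorem IsArc.apply_zero_ne {f : Fin 5 → ℕ} (hf : IsArc f) : f 0 ≠ 28 := by
  intro h0
  have hmem : ∀ i, i ≠ 0 → f i ∈ neighbors pgLines 28 := fun i hi =>
    h0 ▸ hf.mem_neighbors hi.symm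
  have hjoined : ∀ i j, i ≠ j ∧ 0 ≠ i ∧ 0 ≠ j → JoinedOff 28 (f i) (f j) := fun i j h =>
    h0 ▸ hf.joinedOff h.1 h.2.1 h.2.2
  exact no_four_joinedOff (f 1) (hmem 1 (by decide)) (f 2) (hmem 2 (by decide))
    (hjoined 1 2 (by decide)) (f 3) (hmem 3 (by decide)) (hjoined 1 3 (by decide))
    (hjoined 2 3 (by decide)) (f 4) (hmem 4 (by decide)) (hjoined 1 4 (by decide))
    (hjoined 2 4 (by decide)) (hjoined 3 4 (by decide))

theorem not_mem_orbit_one : 28 ∉ MulAction.orbit autGroup 1 := by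
  rintro ⟨g, hg⟩
  exact (isArc_one.comp_isAut g.2).apply_zero_ne hg

/-- The points of the larger orbit. -/
def bigPoints : Finset ℕ := pgPoints \ Finset.Icc 28 54

/-- The lines of the larger orbit. -/
def bigLines : Finset (Finset ℕ) := pgLines.filter fun l => ∃ x ∈ l, x ∈ Finset.Icc 28 54

theorem bigPoints_subset : ∀ x ∈ bigPoints, x ∈ MulAction.orbit autGroup 1 := fun x hx =>
  iterate_orbitStep_subset_orbit autGroup isAut_genA isAut_genB 1 6 x
    ((by decide +kernel : bigPoints ⊆ (orbitStep genA genB)^[6] {1}) hx)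

theorem smallPoints_subset : ∀ x ∈ pgPoints \ bigPoints, x ∈ MulAction.orbit autGroup 28 :=
  fun x hx => iterate_orbitStep_subset_orbit autGroup isAut_genA isAut_genB 28 6 x
    ((by decide +kernel : pgPoints \ bigPoints ⊆ (orbitStep genA genB)^[6] {28}) hx)

theorem bigLines_subset :
    ∀ B ∈ bigLines, B ∈ MulAction.orbit autGroup ({1, 8, 16, 32, 35, 38} : Finset ℕ) :=
  fun B hB => iterate_orbitStep_subset_orbit autGroup isAut_genA isAut_genB _ 7 B
    ((by decide +kernel :
      bigLines ⊆ (orbitStep genA genB)^[7] {{1, 8, 16, 32, 35, 38}}) hB)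

theorem smallLines_subset :
    ∀ B ∈ pgLines \ bigLines, B ∈ MulAction.orbit autGroup ({1, 14, 26, 59, 64, 71} : Finset ℕ) :=
  fun B hB => iterate_orbitStep_subset_orbit autGroup isAut_genA isAut_genB _ 6 B
    ((by decide +kernel :
      pgLines \ bigLines ⊆ (orbitStep genA genB)^[6] {{1, 14, 26, 59, 64, 71}}) hB)

theorem line_not_mem_orbit : ({1, 14, 26, 59, 64, 71} : Finset ℕ) ∉
    MulAction.orbit autGroup ({1, 8, 16, 32, 35, 38} : Finset ℕ) := by
  rw [MulAction.mem_orbit_symm]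
  rintro ⟨g, hg⟩
  have h32 : 32 ∈ g • ({1, 14, 26, 59, 64, 71} : Finset ℕ) := by
    rw [show g • ({1, 14, 26, 59, 64, 71} : Finset ℕ) = _ from hg]
    decide
  obtain ⟨x, hx, hgx⟩ := Finset.mem_image.1 h32
  have hx1 : x ∈ MulAction.orbit autGroup 1 := bigPoints_subset x
    ((by decide : ({1, 14, 26, 59, 64, 71} : Finset ℕ) ⊆ bigPoints) hx)
  have h32' : 32 ∈ MulAction.orbit autGroup 1 := hgx ▸ MulAction.mem_orbit_of_mem_orbit g hx1
  have h28 : 32 ∈ MulAction.orbit autGroup 28 := smallPoints_subset 32 (by decide)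
  refine not_mem_orbit_one (MulAction.orbit_eq_iff.1 ?_)
  exact (MulAction.orbit_eq_iff.2 h28).symm.trans (MulAction.orbit_eq_iff.2 h32')

/-- The full automorphism group of the incidence structure `(P, L)` partitions
the point set `P` into exactly two orbits, of sizes 54 and 27, and partitions
the line set `L` into exactly two orbits, of sizes 54 and 27; in particular,
the automorphism group is not transitive on `P`. -/
theorem aut_orbits :
    (∃ O₁ O₂ : Set ℕ, O₁ ≠ O₂ ∧ O₁.ncard = 54 ∧ O₂.ncard = 27 ∧
      {O : Set ℕ | ∃ x ∈ pgPoints, O = pointOrbit x} = {O₁, O₂}) ∧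
    (∃ Q₁ Q₂ : Set (Finset ℕ), Q₁ ≠ Q₂ ∧ Q₁.ncard = 54 ∧ Q₂.ncard = 27 ∧
      {Q : Set (Finset ℕ) | ∃ B ∈ pgLines, Q = lineOrbit B} = {Q₁, Q₂}) ∧
    ¬ (∀ x ∈ pgPoints, ∀ y ∈ pgPoints,
        ∃ g : Equiv.Perm ℕ, IsAut g ∧ g x = y) := by
  refine ⟨?_, ?_, fun h => not_mem_orbit_one ?_⟩
  · simp only [pointOrbit_eq_orbit]
    obtain ⟨O₁, O₂, hne, h₁, h₂, h⟩ := exists_two_orbits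
      (fun (g : autGroup) x hx => smul_mem_pgPoints g hx) Finset.sdiff_subset (by decide +kernel)
      (by decide +kernel) bigPoints_subset smallPoints_subset not_mem_orbit_one
    exact ⟨O₁, O₂, hne, h₁.trans (by decide +kernel), h₂.trans (by decide +kernel), h⟩
  · simp only [lineOrbit_eq_orbit]
    obtain ⟨Q₁, Q₂, hne, h₁, h₂, h⟩ := exists_two_orbits
      (fun (g : autGroup) B hB => smul_mem_pgLines g hB) (Finset.filter_subset _ _)
      (by decide +kernel) (by decide +kernel) bigLines_subset smallLines_subset line_not_mem_orbit
    exact ⟨Q₁, Q₂, hne, h₁.trans (by decide +kernel), h₂.trans (by decide +kernel), h⟩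
  · rw [← pointOrbit_eq_orbit]
    exact h 1 (by decide) 28 (by decide)
end

section
/- There exists a finite partial geometry with parameters pg(5,5,2) whose full automorphism group does not act transitively on the set of points; consequently, there exists a pg(5,5,2) not isomorphic to any pg(5,5,2) whose automorphism group is point-transitive. -/
/-- A finite incidence structure `Inc : P → L → Prop` is a partial geometry
with parameters `pg(s,t,a)` (for integers `s, t, a ≥ 1`) if:
(1) any two distinct points are incident with at most one common line;
(2) every line is incident with exactly `s+1` points;
(3) every point is incident with exactly `t+1` lines;
(4) for every point `p` not incident with a line `l`, there are exactly `a`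
lines incident with `p` and incident with some point of `l`. -/
structure IsPartialGeometry {P L : Type*} [Fintype P] [Fintype L]
    (Inc : P → L → Prop) (s t a : ℕ) : Prop where
  one_le_s : 1 ≤ s
  one_le_t : 1 ≤ t
  one_le_a : 1 ≤ a
  unique_line : ∀ ⦃p q : P⦄, p ≠ q → ∀ ⦃l m : L⦄,
    Inc p l → Inc q l → Inc p m → Inc q m → l = m
  line_card : ∀ l : L, Nat.card {p : P // Inc p l} = s + 1
  point_card : ∀ p : P, Nat.card {l : L // Inc p l} = t + 1
  alpha_card : ∀ (p : P) (l : L), ¬ Inc p l →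
    Nat.card {m : L // Inc p m ∧ ∃ q : P, Inc q l ∧ Inc q m} = a


section Configurations

variable {P L P' L' : Type*}

/-- Two points are joined if they are distinct and lie on a common line. -/
def JoinedPoints (Inc : P → L → Prop) (p q : P) : Prop :=
  p ≠ q ∧ ∃ l, Inc p l ∧ Inc q l

/-- Three pairwise joined points `p, q, r` that do not lie on a common line, where `p` and `q`
are already known to be joined. -/
def IsApex (Inc : P → L → Prop) (p q r : P) : Prop :=
  JoinedPoints Inc q r ∧ JoinedPoints Inc p r ∧ ¬ ∃ l, Inc p l ∧ Inc q l ∧ Inc r l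

/-- The point `p` lies on a segment `p, q` over which there are three pairwise joined apices. -/
def HasTripleApex (Inc : P → L → Prop) (p : P) : Prop :=
  ∃ q r s t, JoinedPoints Inc p q ∧ IsApex Inc p q r ∧ IsApex Inc p q s ∧ IsApex Inc p q t ∧
    JoinedPoints Inc r s ∧ JoinedPoints Inc r t ∧ JoinedPoints Inc s t

variable {Inc : P → L → Prop} {Inc' : P' → L' → Prop} {f : P ≃ P'} {g : L ≃ L'}

theorem JoinedPoints.map (h : ∀ x l, Inc x l ↔ Inc' (f x) (g l)) {p q : P}
    (hpq : JoinedPoints Inc p q) : JoinedPoints Inc' (f p) (f q) := by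
  obtain ⟨hne, l, hp, hq⟩ := hpq
  exact ⟨f.injective.ne hne, g l, (h _ _).1 hp, (h _ _).1 hq⟩

theorem IsApex.map (h : ∀ x l, Inc x l ↔ Inc' (f x) (g l)) {p q r : P} (hr : IsApex Inc p q r) :
    IsApex Inc' (f p) (f q) (f r) := by
  refine ⟨hr.1.map h, hr.2.1.map h, ?_⟩
  rintro ⟨l, hl⟩
  refine hr.2.2 ⟨g.symm l, ?_⟩
  simpa [h] using hl

theorem HasTripleApex.map (h : ∀ x l, Inc x l ↔ Inc' (f x) (g l)) {p : P}
    (hp : HasTripleApex Inc p) : HasTripleApex Inc' (f p) := by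
  obtain ⟨q, r, s, t, hq, hr, hs, ht, hrs, hrt, hst⟩ := hp
  exact ⟨f q, f r, f s, f t, hq.map h, hr.map h, hs.map h, ht.map h, hrs.map h, hrt.map h,
    hst.map h⟩

/-- Point-transitivity is invariant under isomorphism. -/
theorem pointTransitive_of_iso (h : ∀ x l, Inc x l ↔ Inc' (f x) (g l))
    (htrans : ∀ p q : P', ∃ (gP : Equiv.Perm P') (gL : Equiv.Perm L'),
      (∀ x l, Inc' x l ↔ Inc' (gP x) (gL l)) ∧ gP p = q) (p q : P) :
    ∃ (gP : Equiv.Perm P) (gL : Equiv.Perm L),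
      (∀ x l, Inc x l ↔ Inc (gP x) (gL l)) ∧ gP p = q := by
  obtain ⟨a, b, hab, hpq⟩ := htrans (f p) (f q)
  refine ⟨(f.trans a).trans f.symm, (g.trans b).trans g.symm, fun x l => ?_, by simp [hpq]⟩
  rw [h, hab, h]
  simp

end Configurations

namespace NewGeometry

/-- The elementary abelian group of order 27 (coordinatewise addition modulo 3), acting
semiregularly with three orbits on the points and three orbits on the lines of the geometry. -/
abbrev V : Type := Fin 3 × Fin 3 × Fin 3

/-- `block i j` is the set of positions, in the `i`-th orbit of points, of the points on the base
line of the `j`-th orbit of lines. -/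
def block : Fin 3 → Fin 3 → List V
  | 0, 1 => [(0, 0, 0), (1, 2, 1), (1, 0, 2)]
  | 0, 2 => [(0, 0, 0), (1, 2, 2), (0, 2, 1)]
  | 1, 0 => [(0, 0, 0), (1, 0, 0), (0, 1, 0)]
  | 1, 1 => [(0, 0, 0), (0, 0, 1), (2, 2, 2)]
  | 2, 0 => [(0, 0, 0), (0, 0, 1), (2, 2, 2)]
  | 2, 2 => [(0, 0, 0), (1, 0, 0), (0, 1, 0)]
  | _, _ => []

/-- Incidence between the point `p` and the line `l`. -/
def Inc (p l : Fin 3 × V) : Prop := p.2 - l.2 ∈ block p.1 l.1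

instance : DecidableRel Inc := fun p l => inferInstanceAs (Decidable (_ ∈ block p.1 l.1))

/-- Translation by `v`. -/
def translate (v : V) : Equiv.Perm (Fin 3 × V) :=
  Equiv.prodCongr (Equiv.refl _) (Equiv.addRight v)

theorem inc_translate (v : V) (p l : Fin 3 × V) :
    Inc (translate v p) (translate v l) ↔ Inc p l := by
  simp [Inc, translate]

theorem translate_neg_snd (p : Fin 3 × V) : translate (-p.2) p = (p.1, 0) := by
  simp [translate, Prod.map]

/-- The lines through `p`. -/
def linesThrough (p : Fin 3 × V) : List (Fin 3 × V) :=
  (List.finRange 3).flatMap fun j => (block p.1 j).map fun a => (j, p.2 - a)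

/-- The points on `l`. -/
def pointsOn (l : Fin 3 × V) : List (Fin 3 × V) :=
  (List.finRange 3).flatMap fun i => (block i l.1).map fun a => (i, l.2 + a)

theorem mem_linesThrough {p l : Fin 3 × V} : l ∈ linesThrough p ↔ Inc p l := by
  simp only [linesThrough, List.mem_flatMap, List.mem_finRange, true_and, List.mem_map, Inc]
  constructor
  · rintro ⟨j, a, ha, rfl⟩
    simpa using ha
  · exact fun h => ⟨l.1, _, h, by simp⟩

theorem mem_pointsOn {p l : Fin 3 × V} : p ∈ pointsOn l ↔ Inc p l := by
  simp only [pointsOn, List.mem_flatMap, List.mem_finRange, true_and, List.mem_map, Inc]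
  constructor
  · rintro ⟨i, a, ha, rfl⟩
    simpa using ha
  · exact fun h => ⟨p.1, _, h, by simp⟩

instance (p : Fin 3 × V) (Q : Fin 3 × V → Prop) [DecidablePred Q] :
    Decidable (∃ l, Inc p l ∧ Q l) :=
  decidable_of_iff (∃ l ∈ linesThrough p, Q l) (by simp only [mem_linesThrough])

instance (l : Fin 3 × V) (Q : Fin 3 × V → Prop) [DecidablePred Q] :
    Decidable (∃ p, Inc p l ∧ Q p) :=
  decidable_of_iff (∃ p ∈ pointsOn l, Q p) (by simp only [mem_pointsOn])

instance : DecidableRel (JoinedPoints Inc) := fun p q =>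
  inferInstanceAs (Decidable (p ≠ q ∧ ∃ l, Inc p l ∧ Inc q l))

instance (p q r : Fin 3 × V) : Decidable (IsApex Inc p q r) :=
  inferInstanceAs (Decidable (_ ∧ _ ∧ ¬ ∃ l, Inc p l ∧ Inc q l ∧ Inc r l))

/-- The points joined to `p`, together with `p` itself. -/
def neighbors (p : Fin 3 × V) : List (Fin 3 × V) := (linesThrough p).flatMap pointsOn

/-- The points `r` with `IsApex Inc p q r`. -/
def apices (p q : Fin 3 × V) : List (Fin 3 × V) := (neighbors p).filter (IsApex Inc p q ·)

theorem JoinedPoints.mem_neighbors {p q : Fin 3 × V} (h : JoinedPoints Inc p q) :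
    q ∈ neighbors p := by
  obtain ⟨-, l, hp, hq⟩ := h
  exact List.mem_flatMap.2 ⟨l, mem_linesThrough.2 hp, mem_pointsOn.2 hq⟩

theorem IsApex.mem_apices {p q r : Fin 3 × V} (h : IsApex Inc p q r) : r ∈ apices p q := by
  simpa [apices, h] using JoinedPoints.mem_neighbors h.2.1

theorem card_points_base :
    ∀ j, (Finset.univ.filter fun p => Inc p (j, 0)).card = 6 := by
  decide +kernel

theorem card_lines_base :
    ∀ i, (Finset.univ.filter fun l => Inc (i, 0) l).card = 6 := by
  decide +kernel

theorem eq_base_of_inc :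
    ∀ i, ∀ l ∈ linesThrough (i, 0), ∀ m ∈ linesThrough (i, 0), l ≠ m →
      ∀ q ∈ pointsOn l, Inc q m → q = (i, 0) := by
  decide +kernel

theorem card_transversals_base :
    ∀ i l, ¬ Inc (i, 0) l →
      ((linesThrough (i, 0)).toFinset.filter fun m => ∃ q, Inc q l ∧ Inc q m).card = 2 := by
  decide +kernel

theorem isPartialGeometry : IsPartialGeometry Inc 5 5 2 where
  one_le_s := by norm_num
  one_le_t := by norm_num
  one_le_a := by norm_num
  unique_line p q hpq l m hpl hql hpm hqm := by
    by_contra hlm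
    set T := translate (-p.2)
    have key := eq_base_of_inc p.1 (T l) (mem_linesThrough.2 ?_) (T m) (mem_linesThrough.2 ?_)
      (T.injective.ne hlm) (T q) (mem_pointsOn.2 ((inc_translate _ _ _).2 hql))
      ((inc_translate _ _ _).2 hqm)
    · rw [← translate_neg_snd] at key
      exact hpq (T.injective key).symm
    · rw [← translate_neg_snd]
      exact (inc_translate _ _ _).2 hpl
    · rw [← translate_neg_snd]
      exact (inc_translate _ _ _).2 hpm
  line_card l := by
    rw [show 5 + 1 = 6 from rfl, ← card_points_base l.1, ← Fintype.card_subtype,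
      ← Nat.card_eq_fintype_card, ← translate_neg_snd l]
    exact Nat.card_congr ((translate (-l.2)).subtypeEquiv fun p => (inc_translate _ _ _).symm)
  point_card p := by
    rw [show 5 + 1 = 6 from rfl, ← card_lines_base p.1, ← Fintype.card_subtype,
      ← Nat.card_eq_fintype_card, ← translate_neg_snd p]
    exact Nat.card_congr ((translate (-p.2)).subtypeEquiv fun l => (inc_translate _ _ _).symm)
  alpha_card p l hpl := by
    set T := translate (-p.2)
    have h : ¬ Inc (p.1, 0) (T l) := by
      rwa [← translate_neg_snd, inc_translate]
    have hfilter : (linesThrough (p.1, 0)).toFinset.filter (fun m => ∃ q, Inc q (T l) ∧ Inc q m) =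
        Finset.univ.filter fun m => Inc (p.1, 0) m ∧ ∃ q, Inc q (T l) ∧ Inc q m := by
      ext m
      simp [mem_linesThrough]
    rw [← card_transversals_base p.1 (T l) h, hfilter, ← Fintype.card_subtype,
      ← Nat.card_eq_fintype_card, ← translate_neg_snd p]
    refine Nat.card_congr (T.subtypeEquiv fun m => ?_)
    rw [inc_translate]
    exact and_congr_right' (T.exists_congr fun q => by simp only [T, inc_translate])

theorem not_hasTripleApex : ¬ HasTripleApex Inc (0, 0) := by
  have key : ∀ q ∈ neighbors (0, 0), ∀ r ∈ apices (0, 0) q, ∀ s ∈ apices (0, 0) q,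
      JoinedPoints Inc r s → ∀ t ∈ apices (0, 0) q, JoinedPoints Inc r t →
        ¬ JoinedPoints Inc s t := by
    decide +kernel
  rintro ⟨q, r, s, t, hq, hr, hs, ht, hrs, hrt, hst⟩
  exact key q (JoinedPoints.mem_neighbors hq) r (IsApex.mem_apices hr) s
    (IsApex.mem_apices hs) hrs t (IsApex.mem_apices ht) hrt hst

theorem hasTripleApex : HasTripleApex Inc (1, 0) :=
  ⟨(1, 0, 0, 1), (1, 1, 1, 2), (2, 0, 0, 1), (2, 0, 2, 1), by decide +kernel⟩

theorem not_pointTransitive :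
    ¬ ∀ p q : Fin 3 × V, ∃ gP gL : Equiv.Perm (Fin 3 × V),
      (∀ x l, Inc x l ↔ Inc (gP x) (gL l)) ∧ gP p = q := by
  intro h
  obtain ⟨f, g, hfg, hf⟩ := h (1, 0) (0, 0)
  exact not_hasTripleApex (hf ▸ hasTripleApex.map hfg)

end NewGeometry

/-- There exists a finite partial geometry `pg(5,5,2)` whose full automorphism
group (pairs of permutations of points and lines preserving incidence) is not
transitive on the point set; consequently, there exists a `pg(5,5,2)` not
isomorphic to any `pg(5,5,2)` whose automorphism group is point-transitive. -/
theorem exists_nontransitive_pg552 :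
    ∃ (P L : Type) (_ : Fintype P) (_ : Fintype L) (Inc : P → L → Prop),
      IsPartialGeometry Inc 5 5 2 ∧
      ¬ (∀ p q : P, ∃ (gP : Equiv.Perm P) (gL : Equiv.Perm L),
          (∀ (x : P) (l : L), Inc x l ↔ Inc (gP x) (gL l)) ∧ gP p = q) ∧
      ∀ (P' L' : Type) (_ : Fintype P') (_ : Fintype L') (Inc' : P' → L' → Prop),
        IsPartialGeometry Inc' 5 5 2 →
        (∀ p q : P', ∃ (gP : Equiv.Perm P') (gL : Equiv.Perm L'),
            (∀ (x : P') (l : L'), Inc' x l ↔ Inc' (gP x) (gL l)) ∧ gP p = q) →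
        ¬ ∃ (eP : P ≃ P') (eL : L ≃ L'),
            ∀ (x : P) (l : L), Inc x l ↔ Inc' (eP x) (eL l) := by
  refine ⟨Fin 3 × NewGeometry.V, Fin 3 × NewGeometry.V, inferInstance, inferInstance,
    NewGeometry.Inc, NewGeometry.isPartialGeometry, NewGeometry.not_pointTransitive, ?_⟩
  rintro P' L' _ _ Inc' _ htrans ⟨f, g, h⟩
  exact NewGeometry.not_pointTransitive (pointTransitive_of_iso h htrans)
end
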